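/- arXiv:2010.13217 — 2 statements merged into one kernel-verified Lean document; each statement's English description precedes it below -/
import Mathlib

section
/- With the notation for f_m below, fix m ∈ {1, …, n} and w ∈ ℂ \ {0} with ϑ(c_m w⁻¹) ≠ 0. Then for every nonzero x ∈ ℂ, f_m(q x, w) = w · q^{−n} · h^{−n} · x^{−n} · (∏_{i=1}^{n} a_i) · f_m(x, w). -/
/-- The q-Pochhammer function `φ(x) = ∏_{n≥0} (1 - qⁿ x)` (formula (3.10) of the paper). -/
noncomputable def phi (q x : ℂ) : ℂ := ∏' n : ℕ, (1 - q ^ n * x)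

/-- The theta function `ϑ(z) = φ(qz) φ(z⁻¹)` (formula (3.13) of the paper). -/
noncomputable def theta (q z : ℂ) : ℂ := phi q (q * z) * phi q z⁻¹

/-- The constant `c_m = (-1)ⁿ h^{2m-n}` of formula (A.6) of the paper
(here `h` is a square root of `ħ`, so `ħ = h²`). -/
noncomputable def cc (n : ℕ) (h : ℂ) (m : ℕ) : ℂ :=
  (-1 : ℂ) ^ n * h ^ (2 * (m : ℤ) - (n : ℤ))

/-- The building block `f_m(x, w)` of the elliptic stable envelope for `T*Gr(k,n)`
(formula (A.6) of the paper):
`f_m(x,w) = (ϑ(c_m x w⁻¹ a_m⁻¹)/ϑ(c_m w⁻¹)) ∏_{i<m} ϑ(x/aᵢ) ∏_{i>m} ϑ(h²x/aᵢ)`. -/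
noncomputable def fEnv (q h : ℂ) (n : ℕ) (a : ℕ → ℂ) (m : ℕ) (x w : ℂ) : ℂ :=
  (theta q (cc n h m * x * w⁻¹ * (a m)⁻¹) / theta q (cc n h m * w⁻¹)) *
    (∏ i ∈ Finset.Ico 1 m, theta q (x / a i)) *
    (∏ i ∈ Finset.Ioc m n, theta q (h ^ 2 * x / a i))

/-- The functional equation `φ(x) = (1 - x) φ(qx)`. -/
theorem phi_eq_one_sub_mul_phi {q : ℂ} (hq1 : ‖q‖ < 1) (x : ℂ) :
    phi q x = (1 - x) * phi q (q * x) := by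
  have hsum : Summable fun n : ℕ => ‖-(q ^ (n + 1) * x)‖ := by
    simp only [norm_neg, norm_mul, norm_pow, pow_succ]
    exact ((summable_geometric_of_lt_one (norm_nonneg q) hq1).mul_right _).mul_right _
  have hmul : Multipliable fun n : ℕ => 1 - q ^ (n + 1) * x := by
    simpa only [sub_eq_add_neg] using multipliable_one_add_of_summable hsum
  unfold phi
  rw [tprod_eq_zero_mul' (f := fun n : ℕ => 1 - q ^ n * x) hmul]
  simp only [pow_zero, one_mul, pow_succ, mul_assoc]

/-- Quasi-periodicity of the theta function: `ϑ(qz) = -(qz)⁻¹ ϑ(z)`. -/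
theorem theta_mul_left {q : ℂ} (hq : q ≠ 0) (hq1 : ‖q‖ < 1) {z : ℂ} (hz : z ≠ 0) :
    theta q (q * z) = -(q * z)⁻¹ * theta q z := by
  have h : q * (q * z)⁻¹ = z⁻¹ := by field_simp
  unfold theta
  rw [phi_eq_one_sub_mul_phi hq1 (q * z)⁻¹, h, phi_eq_one_sub_mul_phi hq1 (q * z)]
  field_simp
  ring

/-- Quasi-periodicity of a product of theta functions `∏ ϑ(cx/aᵢ)` in `x`. -/
theorem prod_theta_mul_left {ι : Type*} {q : ℂ} (hq : q ≠ 0) (hq1 : ‖q‖ < 1) (s : Finset ι)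
    {a : ι → ℂ} (ha : ∀ i ∈ s, a i ≠ 0) {c x : ℂ} (hc : c ≠ 0) (hx : x ≠ 0) :
    ∏ i ∈ s, theta q (c * (q * x) / a i) =
      (-(q * c * x)⁻¹) ^ s.card * (∏ i ∈ s, a i) * ∏ i ∈ s, theta q (c * x / a i) := by
  rw [← Finset.prod_const, ← Finset.prod_mul_distrib, ← Finset.prod_mul_distrib]
  refine Finset.prod_congr rfl fun i hi => ?_
  have hai := ha i hi
  rw [show c * (q * x) / a i = q * (c * x / a i) by ring,
    theta_mul_left hq hq1 (div_ne_zero (mul_ne_zero hc hx) hai)]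
  field_simp

/-- **Quasi-periodicity of `f_m` in `x`** (underlying equation (A.10) of the paper):
`f_m(qx, w) = w q^{-n} h^{-n} x^{-n} (∏ᵢ aᵢ) f_m(x, w)`. -/
theorem fEnv_quasi_periodicity_x
    (q : ℂ) (hq0 : 0 < ‖q‖) (hq1 : ‖q‖ < 1)
    (h : ℂ) (hh : h ≠ 0)
    (n : ℕ) (hn : 1 ≤ n) (a : ℕ → ℂ)
    (ha0 : ∀ i ∈ Finset.Icc 1 n, a i ≠ 0)
    (hdist : ∀ i ∈ Finset.Icc 1 n, ∀ j ∈ Finset.Icc 1 n, i ≠ j → a i ≠ a j)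
    (m : ℕ) (hm : m ∈ Finset.Icc 1 n)
    (w : ℂ) (hw : w ≠ 0) (hwth : theta q (cc n h m * w⁻¹) ≠ 0) :
    ∀ x : ℂ, x ≠ 0 →
      fEnv q h n a m (q * x) w =
        w * q ^ (-(n : ℤ)) * h ^ (-(n : ℤ)) * x ^ (-(n : ℤ)) *
          (∏ i ∈ Finset.Icc 1 n, a i) * fEnv q h n a m x w := by
  intro x hx
  have hq : q ≠ 0 := norm_pos_iff.mp hq0
  obtain ⟨hm1, hmn⟩ := Finset.mem_Icc.mp hm
  have ham := ha0 m hm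
  have hc : cc n h m ≠ 0 := by
    unfold cc
    exact mul_ne_zero (pow_ne_zero _ (by norm_num)) (zpow_ne_zero _ hh)
  have hlow : ∀ i ∈ Finset.Ico 1 m, a i ≠ 0 := fun i hi => by
    rw [Finset.mem_Ico] at hi
    exact ha0 i (Finset.mem_Icc.mpr (by omega))
  have hhigh : ∀ i ∈ Finset.Ioc m n, a i ≠ 0 := fun i hi => by
    rw [Finset.mem_Ioc] at hi
    exact ha0 i (Finset.mem_Icc.mpr (by omega))
  have hsplit : ∏ i ∈ Finset.Icc 1 n, a i =
      (∏ i ∈ Finset.Ico 1 m, a i) * a m * ∏ i ∈ Finset.Ioc m n, a i := by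
    rw [← Finset.prod_Ico_succ_top hm1, ← Finset.Ico_add_one_right_eq_Icc,
      ← Finset.Ico_add_one_add_one_eq_Ioc]
    exact (Finset.prod_Ico_consecutive a (by omega) (by omega)).symm
  have hP := prod_theta_mul_left hq hq1 _ hlow one_ne_zero hx
  simp only [one_mul, mul_one, Nat.card_Ico] at hP
  have hR := prod_theta_mul_left hq hq1 _ hhigh (pow_ne_zero 2 hh) hx
  rw [Nat.card_Ioc] at hR
  have hz : cc n h m * x * w⁻¹ * (a m)⁻¹ ≠ 0 :=
    mul_ne_zero (mul_ne_zero (mul_ne_zero hc hx) (inv_ne_zero hw)) (inv_ne_zero ham)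
  have hconst : -(q * (cc n h m * x * w⁻¹ * (a m)⁻¹))⁻¹ * (-(q * x)⁻¹) ^ (m - 1) *
      (-(q * h ^ 2 * x)⁻¹) ^ (n - m) =
      w * q ^ (-(n : ℤ)) * h ^ (-(n : ℤ)) * x ^ (-(n : ℤ)) * a m := by
    obtain ⟨k, rfl⟩ := Nat.exists_eq_add_of_le' hm1
    obtain ⟨l, rfl⟩ := Nat.exists_eq_add_of_le hmn
    have hcc : cc (k + 1 + l) h (k + 1) * h ^ l = (-1) ^ (k + 1 + l) * h ^ (k + 1) := by
      unfold cc
      rw [mul_assoc, ← zpow_natCast h l, ← zpow_add₀ hh, ← zpow_natCast h (k + 1)]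
      congr 2
      push_cast
      ring
    have hcc' : cc (k + 1 + l) h (k + 1) = (-1) ^ (k + 1 + l) * h ^ (k + 1) / h ^ l :=
      eq_div_of_mul_eq (pow_ne_zero _ hh) hcc
    have hsign : ((-1 : ℂ) ^ (k + 1 + l))⁻¹ = (-1) ^ (k + 1 + l) := by
      rw [← inv_pow, inv_neg_one]
    have hsq : (-1 : ℂ) ^ (k + 1 + l) * (-1) ^ (k + 1 + l) = 1 := by
      rw [← mul_pow]; norm_num
    rw [hcc', zpow_neg, zpow_neg, zpow_neg, zpow_natCast, zpow_natCast, zpow_natCast,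
      Nat.add_sub_cancel, Nat.add_sub_cancel_left, neg_pow (q * x)⁻¹, neg_pow (q * h ^ 2 * x)⁻¹]
    simp only [div_eq_mul_inv, mul_inv, inv_inv, mul_pow, inv_pow, hsign]
    calc _ = ((-1 : ℂ) ^ (k + 1 + l) * (-1) ^ (k + 1 + l)) *
          (w * (q ^ (k + 1 + l))⁻¹ * (h ^ (k + 1 + l))⁻¹ * (x ^ (k + 1 + l))⁻¹ * a (k + 1)) := by
          field_simp
          ring
      _ = _ := by rw [hsq, one_mul]
  unfold fEnv
  rw [show cc n h m * (q * x) * w⁻¹ * (a m)⁻¹ = q * (cc n h m * x * w⁻¹ * (a m)⁻¹) by ring,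
    theta_mul_left hq hq1 hz, hP, hR, hsplit]
  linear_combination (∏ i ∈ Finset.Ico 1 m, a i) * (∏ i ∈ Finset.Ioc m n, a i) *
    (theta q (cc n h m * x * w⁻¹ * (a m)⁻¹) / theta q (cc n h m * w⁻¹)) *
    (∏ i ∈ Finset.Ico 1 m, theta q (x / a i)) *
    (∏ i ∈ Finset.Ioc m n, theta q (h ^ 2 * x / a i)) * hconst
end

section
/- With the notation for f_m below, fix m ∈ {1, …, n} and w ∈ ℂ \ {0} with ϑ(c_m w⁻¹) ≠ 0. Then for every nonzero x ∈ ℂ, f_m(x, q w) = (x/a_m) · f_m(x, w). -/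
/-- The functional equation `φ(x) = (1 - x) φ(qx)`. -/
theorem phi_eq_one_sub_mul {q : ℂ} (hq : ‖q‖ < 1) (x : ℂ) :
    phi q x = (1 - x) * phi q (q * x) := by
  have hs : Summable fun n : ℕ => ‖-(q ^ n * (q * x))‖ := by
    simpa [norm_mul, norm_pow] using
      (summable_geometric_of_lt_one (norm_nonneg q) hq).mul_right (‖q‖ * ‖x‖)
  have hm : Multipliable fun n : ℕ => 1 - q ^ (n + 1) * x := by
    simpa only [← sub_eq_add_neg, pow_succ, mul_assoc] using
      multipliable_one_add_of_summable hs
  have h0 := tprod_eq_zero_mul' (f := fun n : ℕ => 1 - q ^ n * x) hm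
  simpa only [phi, pow_zero, one_mul, pow_succ, mul_assoc] using h0

/-- Quasi-periodicity of the theta function: `ϑ(q⁻¹ z) = -z ϑ(z)`. -/
theorem theta_inv_mul {q : ℂ} (hq0 : q ≠ 0) (hq : ‖q‖ < 1) {z : ℂ} (hz : z ≠ 0) :
    theta q (q⁻¹ * z) = -z * theta q z := by
  rw [theta, theta, mul_inv_cancel_left₀ hq0, mul_inv, inv_inv,
    phi_eq_one_sub_mul hq z, phi_eq_one_sub_mul hq z⁻¹]
  field_simp
  ring

theorem cc_ne_zero (n : ℕ) {h : ℂ} (hh : h ≠ 0) (m : ℕ) : cc n h m ≠ 0 :=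
  mul_ne_zero (pow_ne_zero _ (by norm_num)) (zpow_ne_zero _ hh)

/-- **Quasi-periodicity of `f_m` in the Kähler variable** (corresponding to equation
(3.32) of the paper, `u(s, qz) = s⁻¹ u(s,z)`, for the stable envelope of `T*Gr(k,n)`):
`f_m(x, qw) = (x/a_m) f_m(x, w)`. -/
theorem fEnv_quasi_periodicity_w
    (q : ℂ) (hq0 : 0 < ‖q‖) (hq1 : ‖q‖ < 1)
    (h : ℂ) (hh : h ≠ 0)
    (n : ℕ) (hn : 1 ≤ n) (a : ℕ → ℂ)
    (ha0 : ∀ i ∈ Finset.Icc 1 n, a i ≠ 0)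
    (hdist : ∀ i ∈ Finset.Icc 1 n, ∀ j ∈ Finset.Icc 1 n, i ≠ j → a i ≠ a j)
    (m : ℕ) (hm : m ∈ Finset.Icc 1 n)
    (w : ℂ) (hw : w ≠ 0) (hwth : theta q (cc n h m * w⁻¹) ≠ 0) :
    ∀ x : ℂ, x ≠ 0 →
      fEnv q h n a m x (q * w) = (x / a m) * fEnv q h n a m x w := by
  intro x hx
  have hq : q ≠ 0 := norm_pos_iff.mp hq0
  have ha : a m ≠ 0 := ha0 m hm
  have hc : cc n h m ≠ 0 := cc_ne_zero n hh m
  have hnum : cc n h m * x * (q * w)⁻¹ * (a m)⁻¹ =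
      q⁻¹ * (cc n h m * x * w⁻¹ * (a m)⁻¹) := by
    rw [mul_inv]; ring
  have hden : cc n h m * (q * w)⁻¹ = q⁻¹ * (cc n h m * w⁻¹) := by
    rw [mul_inv]; ring
  have hZ : cc n h m * x * w⁻¹ * (a m)⁻¹ ≠ 0 := by simp [*]
  have hD : cc n h m * w⁻¹ ≠ 0 := mul_ne_zero hc (inv_ne_zero hw)
  have hratio : -(cc n h m * x * w⁻¹ * (a m)⁻¹) / -(cc n h m * w⁻¹) = x / a m := by
    field_simp
  simp only [fEnv]
  rw [hnum, hden, theta_inv_mul hq hq1 hZ, theta_inv_mul hq hq1 hD, mul_div_mul_comm, hratio]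
  ring
end
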